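/- Let X be a quasi-Banach function space over (Ω,μ). Then the following are equivalent: (i) the Köthe dual X' is a Banach function space over (Ω,μ) (i.e. X' is saturated); (ii) there exists a Banach function space E over (Ω,μ) such that X continuously embeds into E. -/

import Mathlib

open MeasureTheory Filter Set Topology

/-- A quasi-Banach function space over the measure space `(Ω, μ)`:
a complete quasi-normed vector subspace of `L⁰(Ω)` satisfying the
ideal property and the saturation property. -/
structure QBFS {Ω : Type*} [MeasurableSpace Ω] (μ : Measure Ω) where
  carrier : Set (Ω → ℝ)
  qnorm : (Ω → ℝ) → ℝ
  K : ℝ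
  one_le_K : 1 ≤ K
  aemeasurable_mem : ∀ f ∈ carrier, AEMeasurable f μ
  zero_mem : (0 : Ω → ℝ) ∈ carrier
  add_mem : ∀ f ∈ carrier, ∀ g ∈ carrier, f + g ∈ carrier
  smul_mem : ∀ (c : ℝ), ∀ f ∈ carrier, c • f ∈ carrier
  qnorm_nonneg : ∀ f ∈ carrier, 0 ≤ qnorm f
  qnorm_eq_zero_iff : ∀ f ∈ carrier, (qnorm f = 0 ↔ f =ᵐ[μ] 0)
  qnorm_smul : ∀ (c : ℝ), ∀ f ∈ carrier, qnorm (c • f) = |c| * qnorm f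
  qnorm_triangle : ∀ f ∈ carrier, ∀ g ∈ carrier, qnorm (f + g) ≤ K * (qnorm f + qnorm g)
  ideal : ∀ f ∈ carrier, ∀ g : Ω → ℝ, AEMeasurable g μ →
      (∀ᵐ x ∂μ, |g x| ≤ |f x|) → g ∈ carrier ∧ qnorm g ≤ qnorm f
  saturated : ∀ E : Set Ω, MeasurableSet E → 0 < μ E →
      ∃ F, F ⊆ E ∧ MeasurableSet F ∧ 0 < μ F ∧ F.indicator (fun _ => (1 : ℝ)) ∈ carrier
  complete : ∀ f : ℕ → Ω → ℝ, (∀ n, f n ∈ carrier) →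
      (∀ ε > 0, ∃ N, ∀ j ≥ N, ∀ k ≥ N, qnorm (f j - f k) < ε) →
      ∃ g ∈ carrier, Tendsto (fun n => qnorm (f n - g)) atTop (𝓝 0)

namespace QBFS

variable {Ω : Type*} [MeasurableSpace Ω] {μ : Measure Ω}

/-- `X` is a *Banach* function space if its quasi-norm is a norm. -/
def IsBanach (X : QBFS μ) : Prop :=
  ∀ f ∈ X.carrier, ∀ g ∈ X.carrier, X.qnorm (f + g) ≤ X.qnorm f + X.qnorm g

/-- The Köthe dual `X'` of `X`. -/
def kotheDual (X : QBFS μ) : Set (Ω → ℝ) :=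
  {g | AEMeasurable g μ ∧ ∀ f ∈ X.carrier, Integrable (fun x => f x * g x) μ}

/-- The Köthe dual norm `‖g‖_{X'} = sup_{‖f‖_X = 1} ‖fg‖_{L¹}`. -/
noncomputable def dualNorm (X : QBFS μ) (g : Ω → ℝ) : ℝ :=
  sSup ((fun f => ∫ x, |f x * g x| ∂μ) '' {f | f ∈ X.carrier ∧ X.qnorm f = 1})

/-- The Fatou property. -/
def Fatou (X : QBFS μ) : Prop :=
  ∀ (f : ℕ → Ω → ℝ) (g : Ω → ℝ), (∀ n, f n ∈ X.carrier) → AEMeasurable g μ →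
    (∀ᵐ x ∂μ, 0 ≤ f 0 x ∧ Monotone (fun n => f n x) ∧
      Tendsto (fun n => f n x) atTop (𝓝 (g x))) →
    BddAbove (Set.range fun n => X.qnorm (f n)) →
    g ∈ X.carrier ∧ X.qnorm g = ⨆ n, X.qnorm (f n)

/-- Order-continuity: if `f_n ↓ 0` a.e. then `‖f_n‖_X → 0`. -/
def OrderContinuous (X : QBFS μ) : Prop :=
  ∀ f : ℕ → Ω → ℝ, (∀ n, f n ∈ X.carrier) →
    (∀ᵐ x ∂μ, Antitone (fun n => f n x) ∧ Tendsto (fun n => f n x) atTop (𝓝 0)) →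
    Tendsto (fun n => X.qnorm (f n)) atTop (𝓝 0)

end QBFS

namespace QBFS

variable {Ω : Type*} [MeasurableSpace Ω] {μ : Measure Ω} (X : QBFS μ)

theorem abs_mem {f : Ω → ℝ} (hf : f ∈ X.carrier) :
    (fun x => |f x|) ∈ X.carrier ∧ X.qnorm (fun x => |f x|) ≤ X.qnorm f :=
  X.ideal f hf _ (X.aemeasurable_mem f hf).abs (.of_forall fun x => by simp)

theorem sum_mem {f : ℕ → Ω → ℝ} (hf : ∀ n, f n ∈ X.carrier) (m : ℕ) :
    (∑ i ∈ Finset.range m, f i) ∈ X.carrier := by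
  induction m with
  | zero => simpa using X.zero_mem
  | succ m ih => rw [Finset.sum_range_succ]; exact X.add_mem _ ih _ (hf m)

theorem sub_mem {f g : Ω → ℝ} (hf : f ∈ X.carrier) (hg : g ∈ X.carrier) :
    f - g ∈ X.carrier := by
  have := X.add_mem _ hf _ (X.smul_mem (-1) _ hg)
  simpa [sub_eq_add_neg] using this

theorem qnorm_zero : X.qnorm 0 = 0 :=
  (X.qnorm_eq_zero_iff 0 X.zero_mem).2 (ae_eq_refl _)

/-- A finite sum of functions with geometrically decaying quasi-norms is controlled by its first
term. -/
theorem qnorm_sum_le {f : ℕ → Ω → ℝ} (hf : ∀ n, f n ∈ X.carrier)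
    (hn : ∀ n, X.qnorm (f n) ≤ ((2 * X.K)⁻¹) ^ n) (m j : ℕ) :
    X.qnorm (∑ i ∈ Finset.range m, f (j + i)) ≤ 2 * X.K * ((2 * X.K)⁻¹) ^ j := by
  have hK := X.one_le_K
  induction m generalizing j with
  | zero => simp only [Finset.range_zero, Finset.sum_empty, X.qnorm_zero]; positivity
  | succ m ih =>
    rw [Finset.sum_range_succ']
    have e : ∑ i ∈ Finset.range m, f (j + (i + 1)) = ∑ i ∈ Finset.range m, f (j + 1 + i) :=
      Finset.sum_congr rfl fun i _ => by rw [add_assoc, add_comm 1 i]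
    rw [e, add_zero]
    have h1 := X.qnorm_triangle _ (X.sum_mem (fun i => hf (j + 1 + i)) m) _ (hf j)
    have h2 := ih (j + 1)
    have h3 := hn j
    have h4 : 2 * X.K * ((2 * X.K)⁻¹) ^ (j + 1) = ((2 * X.K)⁻¹) ^ j := by
      rw [pow_succ]; field_simp
    rw [h4] at h2
    calc _ ≤ _ := h1
      _ ≤ X.K * (((2 * X.K)⁻¹) ^ j + ((2 * X.K)⁻¹) ^ j) := by gcongr
      _ = _ := by ring

/-- A sequence with geometrically decaying quasi-norms has a common majorant in the space. -/
theorem exists_majorant {f : ℕ → Ω → ℝ} (hf : ∀ n, f n ∈ X.carrier)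
    (hn : ∀ n, X.qnorm (f n) ≤ ((2 * X.K)⁻¹) ^ n) :
    ∃ g ∈ X.carrier, ∀ n, ∀ᵐ x ∂μ, |f n x| ≤ g x := by
  have hK := X.one_le_K
  set F : ℕ → Ω → ℝ := fun n x => |f n x| with hF
  have hFm : ∀ n, F n ∈ X.carrier := fun n => (X.abs_mem (hf n)).1
  have hFn : ∀ n, X.qnorm (F n) ≤ ((2 * X.K)⁻¹) ^ n := fun n => (X.abs_mem (hf n)).2.trans (hn n)
  set S : ℕ → Ω → ℝ := fun n => ∑ i ∈ Finset.range n, F i with hS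
  have hSm : ∀ n, S n ∈ X.carrier := X.sum_mem hFm
  have hsub : ∀ j m, S (j + m) - S j = ∑ i ∈ Finset.range m, F (j + i) := fun j m => by
    simp [hS, Finset.sum_range_add]
  have hmono : ∀ x, Monotone fun n => S n x := fun x => monotone_nat_of_le_succ fun n => by
    simp [hS, Finset.sum_range_succ, hF]
  have key : ∀ N j k, N ≤ j → N ≤ k → X.qnorm (S j - S k) ≤ 2 * X.K * ((2 * X.K)⁻¹) ^ N := by
    intro N j k hj hk
    wlog hjk : j ≤ k generalizing j k
    · refine le_trans ?_ (this k j hk hj (by omega))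
      refine (X.ideal _ (X.sub_mem (hSm k) (hSm j)) _
        (X.aemeasurable_mem _ (X.sub_mem (hSm j) (hSm k))) (.of_forall fun x => ?_)).2
      simp [abs_sub_comm]
    obtain ⟨m, rfl⟩ := Nat.exists_eq_add_of_le (hj.trans hjk)
    have hle := X.qnorm_sum_le hFm hFn m N
    rw [← hsub] at hle
    refine le_trans (X.ideal _ (X.sub_mem (hSm (N + m)) (hSm N)) _
      (X.aemeasurable_mem _ (X.sub_mem (hSm j) (hSm _))) (.of_forall fun x => ?_)).2 hle
    have h1 := hmono x hj
    have h2 := hmono x hjk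
    simp only at h1 h2
    simp only [Pi.sub_apply]
    rw [abs_of_nonpos (by linarith), abs_of_nonneg (by linarith)]
    linarith
  have hlim : Tendsto (fun N => 2 * X.K * ((2 * X.K)⁻¹) ^ N) atTop (𝓝 0) := by
    have : Tendsto (fun N => ((2 * X.K)⁻¹) ^ N) atTop (𝓝 0) :=
      tendsto_pow_atTop_nhds_zero_of_lt_one (by positivity) (inv_lt_one_of_one_lt₀ (by linarith))
    simpa using this.const_mul (2 * X.K)
  obtain ⟨g, hg, hgl⟩ := X.complete S hSm fun ε hε => by
    obtain ⟨N, hN⟩ := (hlim.eventually_lt_const hε).exists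
    exact ⟨N, fun j hj k hk => (key N j k hj hk).trans_lt hN⟩
  refine ⟨g, hg, fun n => ?_⟩
  set P : Ω → ℝ := fun x => max (S (n + 1) x - g x) 0 with hP
  have hPm : AEMeasurable P μ :=
    ((X.aemeasurable_mem _ (hSm (n + 1))).sub (X.aemeasurable_mem _ hg)).max aemeasurable_const
  have hPle : ∀ m, n + 1 ≤ m → P ∈ X.carrier ∧ X.qnorm P ≤ X.qnorm (S m - g) := by
    intro m hm
    refine X.ideal _ (X.sub_mem (hSm m) hg) _ hPm (.of_forall fun x => ?_)
    have h1 := hmono x hm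
    simp only at h1
    simp only [hP, Pi.sub_apply]
    rw [abs_of_nonneg (le_max_right _ _)]
    exact max_le ((by linarith : _ ≤ S m x - g x).trans (le_abs_self _)) (abs_nonneg _)
  have hPc := (hPle _ le_rfl).1
  have hP0 : X.qnorm P = 0 := le_antisymm
    (ge_of_tendsto hgl (eventually_atTop.2 ⟨n + 1, fun m hm => (hPle m hm).2⟩))
    (X.qnorm_nonneg P hPc)
  filter_upwards [(X.qnorm_eq_zero_iff P hPc).1 hP0] with x hx
  have h1 : S (n + 1) x - g x ≤ 0 := by
    have := le_max_left (S (n + 1) x - g x) 0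
    simp only [hP, Pi.zero_apply] at hx
    linarith
  have h2 : |f n x| ≤ S (n + 1) x := by
    have h0 : 0 ≤ S n x := by
      simp only [hS, Finset.sum_apply]; exact Finset.sum_nonneg fun i _ => abs_nonneg _
    have h3 : S (n + 1) x = S n x + |f n x| := by simp [hS, hF, Finset.sum_range_succ]
    linarith
  linarith

/-- Rescaled form of `exists_majorant` for sequences in the unit ball. -/
theorem exists_majorant_of_qnorm_le_one {f : ℕ → Ω → ℝ} (hf : ∀ n, f n ∈ X.carrier)
    (hn : ∀ n, X.qnorm (f n) ≤ 1) :
    ∃ g ∈ X.carrier, ∀ n, ∀ᵐ x ∂μ, |f n x| ≤ (2 * X.K) ^ n * g x := by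
  have hK := X.one_le_K
  obtain ⟨g, hg, h⟩ := X.exists_majorant (f := fun n => ((2 * X.K)⁻¹) ^ n • f n)
    (fun n => X.smul_mem _ _ (hf n)) fun n => by
      rw [X.qnorm_smul _ _ (hf n), abs_of_nonneg (by positivity)]
      exact mul_le_of_le_one_right (by positivity) (hn n)
  refine ⟨g, hg, fun n => ?_⟩
  filter_upwards [h n] with x hx
  simp only [Pi.smul_apply, smul_eq_mul, abs_mul, inv_pow] at hx
  rw [abs_of_nonneg (by positivity)] at hx
  rwa [inv_mul_le_iff₀ (by positivity)] at hx

theorem exists_unit_smul {f : Ω → ℝ} (hf : f ∈ X.carrier) :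
    ∃ c : ℝ, 0 < c ∧ c • f ∈ X.carrier ∧ X.qnorm (c • f) ≤ 1 := by
  have h0 := X.qnorm_nonneg f hf
  refine ⟨(1 + X.qnorm f)⁻¹, by positivity, X.smul_mem _ _ hf, ?_⟩
  rw [X.qnorm_smul _ _ hf, abs_of_nonneg (by positivity), inv_mul_le_iff₀ (by positivity)]
  linarith

theorem indicator_mem_kotheDual_iff {F : Set Ω} (hF : MeasurableSet F) :
    F.indicator (fun _ => (1 : ℝ)) ∈ X.kotheDual ↔ ∀ f ∈ X.carrier, IntegrableOn f F μ := by
  have e : ∀ f : Ω → ℝ, (fun x => f x * F.indicator (fun _ => (1 : ℝ)) x) = F.indicator f := by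
    intro f; ext x; by_cases hx : x ∈ F <;> simp [hx]
  simp only [kotheDual, mem_ofPred_eq, e, integrable_indicator_iff hF]
  exact and_iff_right ((measurable_const.indicator hF).aemeasurable)

/-- If every element of the space is integrable on `F`, the restriction to `L¹(F)` is bounded. -/
theorem exists_setLIntegral_le {F : Set Ω} (h : ∀ f ∈ X.carrier, IntegrableOn f F μ) :
    ∃ C : ℝ, 0 < C ∧
      ∀ f ∈ X.carrier, X.qnorm f ≤ 1 → ∫⁻ x in F, ‖f x‖ₑ ∂μ ≤ ENNReal.ofReal C := by
  have hK := X.one_le_K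
  by_contra! hc
  choose f hf hf1 hfl using fun n : ℕ =>
    hc ((2 * X.K) ^ n * (n + 1)) (by positivity)
  obtain ⟨g, hg, hfg⟩ := X.exists_majorant_of_qnorm_le_one hf hf1
  have hgi : ∫⁻ x in F, ‖g x‖ₑ ∂μ ≠ ⊤ := (h g hg).2.ne
  obtain ⟨n, hn⟩ := ENNReal.exists_nat_gt hgi
  have hle : ∫⁻ x in F, ‖f n x‖ₑ ∂μ ≤
      ENNReal.ofReal ((2 * X.K) ^ n) * ∫⁻ x in F, ‖g x‖ₑ ∂μ := by
    rw [← lintegral_const_mul' _ _ ENNReal.ofReal_ne_top]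
    refine lintegral_mono_ae (ae_restrict_of_ae ?_)
    filter_upwards [hfg n] with x hx
    rw [Real.enorm_eq_ofReal_abs, Real.enorm_eq_ofReal_abs, ← ENNReal.ofReal_mul (by positivity)]
    refine ENNReal.ofReal_le_ofReal (hx.trans ?_)
    gcongr
    exact le_abs_self _
  refine absurd ((hfl n).trans_le (hle.trans (mul_le_mul_right hn.le _))) ?_
  rw [not_lt, ENNReal.ofReal_mul (by positivity)]
  gcongr
  rw [← ENNReal.ofReal_natCast]
  exact ENNReal.ofReal_le_ofReal (by linarith)

/-- On a set of finite measure, the unit ball is bounded in measure. -/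
theorem exists_measure_lt_of_qnorm_le_one (ν : Measure Ω) [IsFiniteMeasure ν] (hν : ν ≪ μ)
    {δ : ENNReal} (hδ : 0 < δ) :
    ∃ M : ℝ, 0 < M ∧ ∀ f ∈ X.carrier, X.qnorm f ≤ 1 → ν {x | M < |f x|} < δ := by
  have hK := X.one_le_K
  by_contra! hc
  choose f hf hf1 hfl using fun n : ℕ =>
    hc ((2 * X.K) ^ n * (n + 1)) (by positivity)
  obtain ⟨g, hg, hfg⟩ := X.exists_majorant_of_qnorm_le_one hf hf1
  have hgm : AEMeasurable g ν := (X.aemeasurable_mem g hg).mono_ac hν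
  have hge : ∀ n : ℕ, δ ≤ ν {x | (n : ℝ) ≤ g x} := fun n => by
    refine (hfl n).trans (measure_mono_ae ?_)
    filter_upwards [hν.ae_le (hfg n)] with x hx hlt
    have hlt : (2 * X.K) ^ n * (n + 1) < |f n x| := hlt
    have : (2 * X.K) ^ n * ((n : ℝ) + 1) < (2 * X.K) ^ n * g x := hlt.trans_le hx
    have := lt_of_mul_lt_mul_left this (by positivity)
    change (n : ℝ) ≤ g x
    linarith
  have hlim := tendsto_measure_iInter_atTop (μ := ν) (s := fun n : ℕ => {x | (n : ℝ) ≤ g x})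
    (fun n => nullMeasurableSet_le aemeasurable_const hgm)
    (fun m n hmn x hx => (Nat.cast_le.2 hmn).trans (show (n : ℝ) ≤ g x from hx))
    ⟨0, measure_ne_top _ _⟩
  have hemp : (⋂ n : ℕ, {x | (n : ℝ) ≤ g x}) = ∅ := by
    refine eq_empty_of_forall_notMem fun x hx => ?_
    obtain ⟨n, hn⟩ := exists_nat_gt (g x)
    exact absurd (mem_iInter.1 hx n) (not_le.2 hn)
  rw [hemp, measure_empty] at hlim
  exact absurd (ge_of_tendsto' hlim hge) (not_le.2 hδ)

/-- The space `L¹(ν)` as a Banach function space over a measure `μ` with the same null sets. -/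
noncomputable def ofL1 (ν : Measure Ω) (hνμ : ν ≪ μ) (hμν : μ ≪ ν)
    (hsat : ∀ E : Set Ω, MeasurableSet E → 0 < μ E →
      ∃ F, F ⊆ E ∧ MeasurableSet F ∧ 0 < μ F ∧ Integrable (F.indicator fun _ => (1 : ℝ)) ν) :
    QBFS μ where
  carrier := {f | Integrable f ν}
  qnorm f := ∫ x, |f x| ∂ν
  K := 1
  one_le_K := le_rfl
  aemeasurable_mem f hf := hf.aemeasurable.mono_ac hμν
  zero_mem := integrable_zero _ _ _
  add_mem f hf g hg := Integrable.add hf hg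
  smul_mem c f hf := Integrable.smul c hf
  qnorm_nonneg f _ := integral_nonneg fun x => abs_nonneg _
  qnorm_eq_zero_iff f hf := by
    rw [integral_eq_zero_iff_of_nonneg (fun x => abs_nonneg _) (Integrable.abs hf)]
    constructor
    · intro h
      filter_upwards [hμν.ae_le h] with x hx
      simpa using hx
    · intro h
      filter_upwards [hνμ.ae_le h] with x hx
      simpa using hx
  qnorm_smul c f _ := by simp [abs_mul, integral_const_mul]
  qnorm_triangle f hf g hg := by
    rw [one_mul, ← integral_add (Integrable.abs hf) (Integrable.abs hg)]
    exact integral_mono (Integrable.abs (Integrable.add hf hg))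
      (Integrable.add (Integrable.abs hf) (Integrable.abs hg)) fun x => abs_add_le _ _
  ideal f hf g hg hgf := by
    have hle : ∀ᵐ x ∂ν, |g x| ≤ |f x| := hνμ.ae_le hgf
    have hgi : Integrable g ν := Integrable.mono hf (hg.mono_ac hνμ).aestronglyMeasurable hle
    exact ⟨hgi, integral_mono_ae hgi.abs (Integrable.abs hf) hle⟩
  saturated := hsat
  complete f hf hc := by
    have hf' : ∀ n, Integrable (f n) ν := hf
    have hnorm : ∀ u v : Ω → ℝ, ∀ (hu : Integrable u ν) (hv : Integrable v ν),
        dist (hu.toL1 u) (hv.toL1 v) = ∫ x, |(u - v) x| ∂ν := by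
      intro u v hu hv
      rw [dist_eq_norm, ← Integrable.toL1_sub, L1.norm_eq_integral_norm]
      refine integral_congr_ae ?_
      filter_upwards [(hu.sub hv).coeFn_toL1] with x hx
      rw [hx, Real.norm_eq_abs]
    have hcauchy : CauchySeq fun n => (hf' n).toL1 (f n) := by
      rw [Metric.cauchySeq_iff]
      intro ε hε
      obtain ⟨N, hN⟩ := hc ε hε
      refine ⟨N, fun j hj k hk => ?_⟩
      rw [hnorm]
      exact hN j hj k hk
    obtain ⟨L, hL⟩ := cauchySeq_tendsto_of_complete hcauchy
    refine ⟨L, L1.integrable_coeFn L, ?_⟩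
    rw [tendsto_iff_dist_tendsto_zero] at hL
    refine hL.congr fun n => ?_
    rw [← hnorm _ _ (hf' n) (L1.integrable_coeFn L), Integrable.toL1_coeFn]

theorem ofL1_isBanach (ν : Measure Ω) (hνμ : ν ≪ μ) (hμν : μ ≪ ν)
    (hsat : ∀ E : Set Ω, MeasurableSet E → 0 < μ E →
      ∃ F, F ⊆ E ∧ MeasurableSet F ∧ 0 < μ F ∧ Integrable (F.indicator fun _ => (1 : ℝ)) ν) :
    (ofL1 ν hνμ hμν hsat).IsBanach := fun f hf g hg =>
  ((ofL1 ν hνμ hμν hsat).qnorm_triangle f hf g hg).trans_eq (one_mul _)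

/-- Exhaustion: a class of sets that is closed under unions and meets every set of positive measure
in positive measure contains a countable cover up to a null set. -/
theorem _root_.MeasureTheory.exists_seq_measure_compl_iUnion_eq_zero [SFinite μ]
    {p : Set Ω → Prop} (h0 : p ∅) (hu : ∀ s t, p s → p t → p (s ∪ t))
    (hp : ∀ E : Set Ω, MeasurableSet E → 0 < μ E →
      ∃ F, F ⊆ E ∧ MeasurableSet F ∧ 0 < μ F ∧ p F) :
    ∃ F : ℕ → Set Ω, (∀ n, MeasurableSet (F n)) ∧ (∀ n, p (F n)) ∧ μ (⋃ n, F n)ᶜ = 0 := by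
  set S : Set ENNReal := μ.toFinite '' {F | MeasurableSet F ∧ p F} with hS
  obtain ⟨u, -, hlim, huS⟩ := exists_seq_tendsto_sSup (S := S) ⟨_, ∅, ⟨.empty, h0⟩, rfl⟩
    (OrderTop.bddAbove S)
  choose F hF hFu using huS
  refine ⟨F, fun n => (hF n).1, fun n => (hF n).2, ?_⟩
  by_contra hne
  obtain ⟨G, hGsub, hGm, hGpos, hGp⟩ :=
    hp _ (MeasurableSet.iUnion fun n => (hF n).1).compl (pos_iff_ne_zero.2 hne)
  have hGpos' : μ.toFinite G ≠ 0 := fun h => hGpos.ne' (absolutelyContinuous_toFinite μ h)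
  have hle : ∀ n, u n + μ.toFinite G ≤ sSup S := fun n => by
    have hdisj : Disjoint (F n) G := by
      rw [Set.disjoint_left]
      exact fun x hx hxG => hGsub hxG (mem_iUnion.2 ⟨n, hx⟩)
    rw [← hFu n, ← measure_union hdisj hGm]
    exact le_sSup ⟨_, ⟨(hF n).1.union hGm, hu _ _ (hF n).2 hGp⟩, rfl⟩
  have hle' : sSup S + μ.toFinite G ≤ sSup S := le_of_tendsto' (hlim.add_const _) hle
  have hfin : sSup S ≠ ⊤ := by
    refine ne_top_of_le_ne_top (measure_ne_top μ.toFinite univ) (sSup_le ?_)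
    rintro _ ⟨s, -, rfl⟩
    exact measure_mono (subset_univ s)
  exact absurd hle' (not_le.2 (ENNReal.lt_add_right hfin hGpos'))

/-- If the Köthe dual is saturated, then the space embeds into a weighted `L¹`-space. -/
theorem exists_ofL1_embedding [SigmaFinite μ]
    (h : ∀ E : Set Ω, MeasurableSet E → 0 < μ E →
      ∃ F, F ⊆ E ∧ MeasurableSet F ∧ 0 < μ F ∧ ∀ f ∈ X.carrier, IntegrableOn f F μ) :
    ∃ E : QBFS μ, E.IsBanach ∧ ∃ C > 0, X.carrier ⊆ E.carrier ∧
      ∀ f ∈ X.carrier, E.qnorm f ≤ C * X.qnorm f := by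
  obtain ⟨F, hFm, hFi, hF0⟩ := exists_seq_measure_compl_iUnion_eq_zero (μ := μ)
    (p := fun F => ∀ f ∈ X.carrier, IntegrableOn f F μ) (fun f _ => integrableOn_empty)
    (fun s t hs ht f hf => (hs f hf).union (ht f hf)) h
  choose C hC0 hC using fun n => X.exists_setLIntegral_le (hFi n)
  set ν : Measure Ω :=
    Measure.sum fun n => ENNReal.ofReal ((1 / 2) ^ n / C n) • μ.restrict (F n) with hν
  have hc0 : ∀ n, 0 < (1 / 2 : ℝ) ^ n / C n := fun n => div_pos (by positivity) (hC0 n)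
  have hνμ : ν ≪ μ := Measure.AbsolutelyContinuous.mk fun s _ hs => by
    rw [hν, Measure.sum_apply_eq_zero]
    intro n
    simp [Measure.absolutelyContinuous_of_le Measure.restrict_le_self hs]
  have hμν : μ ≪ ν := Measure.AbsolutelyContinuous.mk fun s hsm hs => by
    rw [hν, Measure.sum_apply_eq_zero] at hs
    have hs' : ∀ n, μ (s ∩ F n) = 0 := fun n => by
      have := hs n
      rw [Measure.smul_apply, smul_eq_mul, mul_eq_zero, Measure.restrict_apply hsm] at this
      exact this.resolve_left (ENNReal.ofReal_pos.2 (hc0 n)).ne'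
    refine measure_mono_null (t := (⋃ n, s ∩ F n) ∪ (⋃ n, F n)ᶜ) (fun x hx => ?_)
      (measure_union_null (measure_iUnion_null hs') hF0)
    by_cases hxF : x ∈ ⋃ n, F n
    · rw [← inter_iUnion]; exact Or.inl ⟨hx, hxF⟩
    · exact Or.inr hxF
  have hball : ∀ f ∈ X.carrier, X.qnorm f ≤ 1 → ∫⁻ x, ‖f x‖ₑ ∂ν ≤ ENNReal.ofReal 2 := by
    intro f hf hf1
    have h2 : ENNReal.ofReal 2 = ∑' n : ℕ, ENNReal.ofReal ((1 / 2) ^ n) := by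
      rw [← ENNReal.ofReal_tsum_of_nonneg (fun n => by positivity) summable_geometric_two,
        tsum_geometric_two]
    rw [hν, lintegral_sum_measure, h2]
    refine ENNReal.tsum_le_tsum fun n => ?_
    rw [lintegral_smul_measure, smul_eq_mul]
    calc _ ≤ ENNReal.ofReal ((1 / 2) ^ n / C n) * ENNReal.ofReal (C n) :=
          mul_le_mul_right (hC n f hf hf1) _
      _ = _ := by rw [← ENNReal.ofReal_mul (hc0 n).le, div_mul_cancel₀ _ (hC0 n).ne']
  have hmeas : ∀ f ∈ X.carrier, AEStronglyMeasurable f ν := fun f hf =>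
    ((X.aemeasurable_mem f hf).mono_ac hνμ).aestronglyMeasurable
  have hInt : ∀ f ∈ X.carrier, Integrable f ν := fun f hf => by
    obtain ⟨c, hc, hcf, hcf1⟩ := X.exists_unit_smul hf
    have : Integrable (c • f) ν :=
      ⟨hmeas _ hcf, (hball _ hcf hcf1).trans_lt ENNReal.ofReal_lt_top⟩
    exact (integrable_smul_iff hc.ne' f).1 this
  have hbound : ∀ f ∈ X.carrier, X.qnorm f ≤ 1 → ∫ x, |f x| ∂ν ≤ 2 := fun f hf hf1 => by
    have := integral_norm_eq_lintegral_enorm (hmeas f hf)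
    simp only [Real.norm_eq_abs] at this
    rw [this]
    exact ENNReal.toReal_le_of_le_ofReal zero_le_two (hball f hf hf1)
  have hsat : ∀ E : Set Ω, MeasurableSet E → 0 < μ E → ∃ F, F ⊆ E ∧ MeasurableSet F ∧ 0 < μ F ∧
      Integrable (F.indicator fun _ => (1 : ℝ)) ν := fun E hE hE0 => by
    obtain ⟨G, hGE, hGm, hG0, hG⟩ := X.saturated E hE hE0
    exact ⟨G, hGE, hGm, hG0, hInt _ hG⟩
  have hle : ∀ f ∈ X.carrier, ∫ x, |f x| ∂ν ≤ 2 * X.qnorm f := fun f hf => by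
    rcases (X.qnorm_nonneg f hf).eq_or_lt with h0 | h0
    · have hz : (fun x => |f x|) =ᵐ[ν] 0 := by
        filter_upwards [hνμ.ae_le ((X.qnorm_eq_zero_iff f hf).1 h0.symm)] with x hx
        simpa using hx
      rw [integral_congr_ae hz, ← h0]
      simp
    · have h1 := hbound ((X.qnorm f)⁻¹ • f) (X.smul_mem _ _ hf) (by
        rw [X.qnorm_smul _ _ hf, abs_of_pos (inv_pos.2 h0), inv_mul_cancel₀ h0.ne'])
      simp only [Pi.smul_apply, smul_eq_mul, abs_mul, integral_const_mul,
        abs_of_pos (inv_pos.2 h0)] at h1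
      rwa [inv_mul_le_iff₀ h0, mul_comm] at h1
  exact ⟨ofL1 ν hνμ hμν hsat, ofL1_isBanach ν hνμ hμν hsat, 2, two_pos, hInt, hle⟩

/-- If every element of `s` is bounded by `M` on at least half of the space, then the constant
`2 * M` is not in the `L²`-closure of `s`. -/
theorem _root_.MeasureTheory.Lp.const_two_mul_notMem_closure (ν : Measure Ω) [IsFiniteMeasure ν]
    {M : ℝ} (hM : 0 < M)
    (hν : ν univ ≠ 0) {s : Set (Lp ℝ 2 ν)}
    (hs : ∀ u ∈ s, ν {x | M < |u x|} < ν univ / 2) :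
    Lp.const 2 ν (2 * M) ∉ closure s := by
  intro hmem
  obtain ⟨u, hus, hlim⟩ := mem_closure_iff_seq_limit.1 hmem
  have htm := tendstoInMeasure_iff_dist.1 (tendstoInMeasure_of_tendsto_Lp hlim) M hM
  have hge : ∀ n, ν univ / 2 ≤ ν {x | M ≤ dist (u n x) (Lp.const 2 ν (2 * M) x)} := fun n => by
    have hle : ν univ ≤
        ν {x | M < |u n x|} + ν {x | M ≤ dist (u n x) (Lp.const 2 ν (2 * M) x)} := by
      refine le_trans (measure_mono_ae ?_) (measure_union_le _ _)
      filter_upwards [Lp.coeFn_const (p := 2) (μ := ν) (2 * M)] with x hx _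
      by_cases hxM : M < |u n x|
      · exact Or.inl hxM
      · refine Or.inr ?_
        change M ≤ dist (u n x) (Lp.const 2 ν (2 * M) x)
        rw [hx, Function.const_apply, Real.dist_eq]
        have := (abs_le.1 (not_lt.1 hxM)).2
        rw [abs_of_nonpos (by linarith)]
        linarith
    by_contra! hlt
    refine absurd (hle.trans_lt (ENNReal.add_lt_add (hs _ (hus n)) hlt)) ?_
    rw [ENNReal.add_halves]
    exact lt_irrefl _
  exact absurd (ge_of_tendsto' htm hge) (not_le.2 (ENNReal.half_pos hν))

/-- The part of the unit ball that lies in `L²(ν)`. -/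
def ballL2 (ν : Measure Ω) : Set (Lp ℝ 2 ν) :=
  {u | ∃ f ∈ X.carrier, X.qnorm f ≤ 1 ∧ u =ᵐ[ν] f}

variable {X}

theorem IsBanach.convex_ballL2 (hX : X.IsBanach) (ν : Measure Ω) : Convex ℝ (X.ballL2 ν) := by
  rintro u ⟨f, hf, hf1, huf⟩ v ⟨g, hg, hg1, hvg⟩ a b ha hb hab
  refine ⟨a • f + b • g, X.add_mem _ (X.smul_mem a f hf) _ (X.smul_mem b g hg), ?_, ?_⟩
  · refine (hX _ (X.smul_mem a f hf) _ (X.smul_mem b g hg)).trans ?_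
    rw [X.qnorm_smul _ _ hf, X.qnorm_smul _ _ hg, abs_of_nonneg ha, abs_of_nonneg hb]
    nlinarith
  · filter_upwards [huf, hvg, Lp.coeFn_add (a • u) (b • v), Lp.coeFn_smul a u, Lp.coeFn_smul b v]
      with x h1 h2 h3 h4 h5
    rw [h3, Pi.add_apply, Pi.add_apply, h4, h5, Pi.smul_apply, Pi.smul_apply, Pi.smul_apply,
      Pi.smul_apply, h1, h2]

/-- In a Banach function space, a finite measure `ν ≪ μ` admits a weight that is positive on a
non-null set and integrates the square-integrable part of the unit ball with a uniform bound. -/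
theorem IsBanach.exists_weight (hX : X.IsBanach) (ν : Measure Ω) [IsFiniteMeasure ν]
    (hνμ : ν ≪ μ) (hν : ν univ ≠ 0) :
    ∃ (g : Ω → ℝ) (C : ℝ), Measurable g ∧ ν {x | 0 < g x} ≠ 0 ∧
      ∀ f ∈ X.carrier, X.qnorm f ≤ 1 → MemLp f 2 ν →
        Integrable (fun x => g x * f x) ν ∧ ∫ x, g x * f x ∂ν ≤ C := by
  obtain ⟨M, hM, hb⟩ := X.exists_measure_lt_of_qnorm_le_one ν hνμ (ENNReal.half_pos hν)
  have hnot := Lp.const_two_mul_notMem_closure ν hM hν (s := X.ballL2 ν) (by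
    rintro u ⟨f, hf, hf1, huf⟩
    refine (measure_congr ?_).trans_lt (hb f hf hf1)
    filter_upwards [huf] with x hx
    change (M < |u x|) = (M < |f x|)
    rw [hx])
  obtain ⟨φ, C, hφ, hφM⟩ := geometric_hahn_banach_closed_point
    (hX.convex_ballL2 ν).closure isClosed_closure hnot
  set g : Lp ℝ 2 ν := (InnerProductSpace.toDual ℝ (Lp ℝ 2 ν)).symm φ with hg
  have hin : ∀ u : Lp ℝ 2 ν, φ u = ∫ x, g x * u x ∂ν := fun u => by
    rw [← InnerProductSpace.toDual_symm_apply, ← hg, L2.inner_def]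
    simp [mul_comm]
  have hC0 : 0 < C := by
    have h0 : (0 : Lp ℝ 2 ν) ∈ X.ballL2 ν :=
      ⟨0, X.zero_mem, by rw [X.qnorm_zero]; exact zero_le_one, Lp.coeFn_zero _ _ _⟩
    simpa using hφ 0 (subset_closure h0)
  refine ⟨g, C, (Lp.stronglyMeasurable g).measurable, fun hz => ?_, fun f hf hf1 hf2 => ?_⟩
  · have hg0 : ∀ᵐ x ∂ν, g x ≤ 0 := by
      rw [ae_iff]; simpa using hz
    have : ∫ x, g x * Lp.const 2 ν (2 * M) x ∂ν ≤ 0 := by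
      refine integral_nonpos_of_ae ?_
      filter_upwards [hg0, Lp.coeFn_const (p := 2) (μ := ν) (2 * M)] with x hx hc
      rw [hc]
      exact mul_nonpos_of_nonpos_of_nonneg hx (by simp; positivity)
    rw [← hin] at this
    linarith
  · have h1 := hφ (hf2.toLp f) (subset_closure ⟨f, hf, hf1, hf2.coeFn_toLp⟩)
    have he : (fun x => g x * hf2.toLp f x) =ᵐ[ν] fun x => g x * f x := by
      filter_upwards [hf2.coeFn_toLp] with x hx
      rw [hx]
    rw [hin, integral_congr_ae he] at h1
    exact ⟨(Lp.memLp g).integrable_mul hf2, h1.le⟩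

/-- The Köthe dual of a Banach function space is saturated. -/
theorem IsBanach.exists_subset_integrableOn [SigmaFinite μ] (hX : X.IsBanach) {E : Set Ω}
    (hE : MeasurableSet E) (hE0 : 0 < μ E) :
    ∃ F, F ⊆ E ∧ MeasurableSet F ∧ 0 < μ F ∧ ∀ f ∈ X.carrier, IntegrableOn f F μ := by
  obtain ⟨A, hAm, hAE, hA0, hAt⟩ := Measure.exists_subset_measure_lt_top hE hE0
  have : IsFiniteMeasure (μ.restrict A) := ⟨by simpa using hAt⟩
  obtain ⟨g, C, hgm, hg0, hgC⟩ := hX.exists_weight (μ.restrict A)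
    (Measure.absolutelyContinuous_of_le Measure.restrict_le_self) (by simpa using hA0.ne')
  have hU : {x | 0 < g x} = ⋃ n : ℕ, {x | 1 / ((n : ℝ) + 1) < g x} := by
    ext x
    simp only [mem_iUnion, mem_ofPred_eq]
    exact ⟨fun h => exists_nat_one_div_lt h, fun ⟨n, hn⟩ => lt_trans (by positivity) hn⟩
  rw [hU] at hg0
  obtain ⟨n, hn⟩ := exists_measure_pos_of_not_measure_iUnion_null hg0
  set ε : ℝ := 1 / ((n : ℝ) + 1) with hε
  have hε0 : 0 < ε := by positivity
  have hGm : MeasurableSet {x | ε < g x} := measurableSet_lt measurable_const hgm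
  set F : Set Ω := {x | ε < g x} ∩ A with hF
  have hFm : MeasurableSet F := hGm.inter hAm
  rw [Measure.restrict_apply hGm] at hn
  refine ⟨F, inter_subset_right.trans hAE, hFm, hn, ?_⟩
  have hball : ∀ f ∈ X.carrier, X.qnorm f ≤ 1 → IntegrableOn f F μ := by
    intro f hf hf1
    have hfm := X.aemeasurable_mem f hf
    set t : ℕ → Ω → ℝ := fun k => F.indicator fun x => min |f x| k with ht
    have htm : ∀ k, AEMeasurable (t k) μ := fun k => (hfm.abs.min aemeasurable_const).indicator hFm
    have ht0 : ∀ k x, 0 ≤ t k x := fun k x => indicator_nonneg (fun y _ => by positivity) x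
    have htf : ∀ k x, t k x ≤ |f x| := fun k x =>
      indicator_le' (fun y _ => min_le_left _ _) (fun y _ => abs_nonneg _) x
    have htk : ∀ k x, t k x ≤ k := fun k x =>
      indicator_le' (fun y _ => min_le_right _ _) (fun y _ => by positivity) x
    have hgt : ∀ k x, ε * t k x ≤ g x * t k x := fun k x => by
      by_cases hx : x ∈ F
      · exact mul_le_mul_of_nonneg_right (le_of_lt hx.1) (ht0 k x)
      · simp [ht, hx]
    have hInt : ∀ k : ℕ, ∫⁻ x in F, ENNReal.ofReal (min |f x| k) ∂μ ≤ ENNReal.ofReal (C / ε) := by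
      intro k
      obtain ⟨htc, ht1⟩ := X.ideal f hf (t k) (htm k)
        (.of_forall fun x => by rw [abs_of_nonneg (ht0 k x)]; exact htf k x)
      have htL : MemLp (t k) 2 (μ.restrict A) :=
        .of_bound (htm k).restrict.aestronglyMeasurable k
          (.of_forall fun x => by rw [Real.norm_of_nonneg (ht0 k x)]; exact htk k x)
      obtain ⟨hi, hle⟩ := hgC _ htc (ht1.trans hf1) htL
      have hti : Integrable (t k) (μ.restrict A) := htL.integrable (by norm_num)
      have h3 : ∫ x in A, t k x ∂μ ≤ C / ε := by
        rw [le_div_iff₀' hε0, ← integral_const_mul]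
        exact (integral_mono (hti.const_mul ε) hi (hgt k)).trans hle
      calc ∫⁻ x in F, ENNReal.ofReal (min |f x| k) ∂μ
          = ∫⁻ x in F, ENNReal.ofReal (t k x) ∂μ :=
            setLIntegral_congr_fun hFm fun x hx => by simp [ht, hx]
        _ ≤ ∫⁻ x in A, ENNReal.ofReal (t k x) ∂μ := lintegral_mono_set inter_subset_right
        _ = ENNReal.ofReal (∫ x in A, t k x ∂μ) :=
            (ofReal_integral_eq_lintegral_ofReal hti (.of_forall (ht0 k))).symm
        _ ≤ _ := ENNReal.ofReal_le_ofReal h3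
    refine ⟨hfm.restrict.aestronglyMeasurable, lt_of_le_of_lt ?_ (ENNReal.ofReal_lt_top (r := C / ε))⟩
    refine le_of_tendsto' (lintegral_tendsto_of_tendsto_of_monotone
      (f := fun (k : ℕ) x => ENNReal.ofReal (min |f x| k))
      (fun k => (hfm.abs.min aemeasurable_const).ennreal_ofReal.restrict)
      (.of_forall fun x k l hkl => ?_) (.of_forall fun x => ?_)) hInt
    · exact ENNReal.ofReal_le_ofReal (min_le_min_left _ (Nat.cast_le.2 hkl))
    · obtain ⟨m, hm⟩ := exists_nat_ge |f x|
      refine tendsto_const_nhds.congr' (eventually_atTop.2 ⟨m, fun k hk => ?_⟩)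
      beta_reduce
      rw [Real.enorm_eq_ofReal_abs, min_eq_left (hm.trans (Nat.cast_le.2 hk))]
  intro f hf
  obtain ⟨c, hc, hcf, hcf1⟩ := X.exists_unit_smul hf
  exact (integrable_smul_iff hc.ne' f).1 (hball _ hcf hcf1)

end QBFS

/-- The Köthe dual `X'` is a Banach function space (i.e. saturated) if and only
if `X` continuously embeds into some Banach function space `E`. -/
theorem kotheDual_saturated_iff_embeds_into_BFS
    {Ω : Type*} [MeasurableSpace Ω] {μ : Measure Ω} [SigmaFinite μ]
    (X : QBFS μ) :
    (∀ E : Set Ω, MeasurableSet E → 0 < μ E →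
        ∃ F, F ⊆ E ∧ MeasurableSet F ∧ 0 < μ F ∧
          F.indicator (fun _ => (1 : ℝ)) ∈ X.kotheDual) ↔
    (∃ E : QBFS μ, E.IsBanach ∧ ∃ C > 0, X.carrier ⊆ E.carrier ∧
        ∀ f ∈ X.carrier, E.qnorm f ≤ C * X.qnorm f) := by
  constructor
  · intro h
    refine X.exists_ofL1_embedding fun E hE hE0 => ?_
    obtain ⟨F, hFE, hFm, hF0, hF⟩ := h E hE hE0
    exact ⟨F, hFE, hFm, hF0, (X.indicator_mem_kotheDual_iff hFm).1 hF⟩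
  · rintro ⟨Y, hY, -, -, hXY, -⟩ E hE hE0
    obtain ⟨F, hFE, hFm, hF0, hF⟩ := hY.exists_subset_integrableOn hE hE0
    exact ⟨F, hFE, hFm, hF0,
      (X.indicator_mem_kotheDual_iff hFm).2 fun f hf => hF f (hXY hf)⟩
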